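/- arXiv:2511.10312 — 4 statements merged into one kernel-verified Lean document; each statement's English description precedes it below -/
import Mathlib

section
/- Let C be a Grothendieck abelian category, let F and G be ℤ-indexed cochain complexes in C all of whose components are injective objects, and let s : F ⟶ G be a morphism of complexes. Then there exist a cochain complex G' in C all of whose components are injective objects, a homotopy equivalence h : G ⟶ G', and a morphism of complexes s' : F ⟶ G' such that every component of s' is a monomorphism and s' is chain homotopic to the composite h ∘ s. -/
open CategoryTheory CategoryTheory.Limits

namespace HomotopyEquiv

variable {C ι : Type*} [Category C] [Preadditive C] [HasBinaryBiproducts C] {c : ComplexShape ι}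

/-- If `L` is contractible, the inclusion `K ⟶ K ⊞ L` is a homotopy equivalence. -/
noncomputable def biprodInl (K L : HomologicalComplex C c) (hL : Homotopy (𝟙 L) 0) :
    HomotopyEquiv K (K ⊞ L) where
  hom := biprod.inl
  inv := biprod.fst
  homotopyHomInvId := Homotopy.ofEq (by simp)
  homotopyInvHomId :=
    ((Homotopy.ofEq (by simp)).trans (((hL.compLeft biprod.snd).compRight biprod.inr).symm.add
      (Homotopy.refl (biprod.fst ≫ biprod.inl)))).trans
      (Homotopy.ofEq (by simp [add_comm]))

end HomotopyEquiv

namespace Homotopy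

variable {C ι : Type*} [Category C] [Preadditive C] [HasBinaryBiproducts C] {c : ComplexShape ι}

/-- If `L` is contractible, then a morphism to `K ⊞ L` only depends up to homotopy on its
first component. -/
noncomputable def biprodLift {M K L : HomologicalComplex C c} (hL : Homotopy (𝟙 L) 0)
    (f : M ⟶ K) (g : M ⟶ L) :
    Homotopy (biprod.lift f g) (f ≫ biprod.inl) :=
  ((Homotopy.ofEq (by simp [biprod.lift_eq])).trans
    ((Homotopy.refl (f ≫ biprod.inl)).add ((hL.compLeft g).compRight biprod.inr))).trans
    (Homotopy.ofEq (by simp))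

end Homotopy

namespace CochainComplex

variable {C : Type*} [Category C] [Preadditive C] [HasBinaryBiproducts C]

lemma injective_biprod_X {K L : CochainComplex C ℤ} (i : ℤ)
    [Injective (K.X i)] [Injective (L.X i)] : Injective ((K ⊞ L).X i) :=
  Injective.of_iso (HomologicalComplex.biprodXIso K L i).symm inferInstance

lemma injective_mappingCone_X {K L : CochainComplex C ℤ} (φ : K ⟶ L) (i : ℤ)
    [Injective (K.X (i + 1))] [Injective (L.X i)] : Injective ((mappingCone φ).X i) :=
  Injective.of_iso
    (HomologicalComplex.homotopyCofiber.XIsoBiprod φ i (i + 1) rfl).symm inferInstance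

lemma mono_mappingCone_inr_f {K L : CochainComplex C ℤ} (φ : K ⟶ L) (i : ℤ) :
    Mono ((mappingCone.inr φ).f i) :=
  mono_of_mono_fac (mappingCone.inr_f_snd_v φ i)

end CochainComplex

/--
Let `C` be a Grothendieck abelian category (abelian, with a separator and exact filtered
colimits), let `F` and `G` be `ℤ`-indexed cochain complexes in `C` whose components are all
injective, and let `s : F ⟶ G` be a morphism of complexes.  Then there exist a cochain
complex `G'` with injective components, a homotopy equivalence `h : G ⟶ G'` and a chain map
`s' : F ⟶ G'` whose components are all monomorphisms, such that `s'` is chain homotopic to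
the composite `s ≫ h.hom`.
-/
theorem presentation_as_degreewise_mono
    {C : Type*} [Category C] [Abelian C] [HasColimits C] [AB5 C] [HasSeparator C]
    (F G : CochainComplex C ℤ)
    (hF : ∀ i, Injective (F.X i)) (hG : ∀ i, Injective (G.X i))
    (s : F ⟶ G) :
    ∃ (G' : CochainComplex C ℤ) (_ : ∀ i, Injective (G'.X i))
      (h : HomotopyEquiv G G') (s' : F ⟶ G'),
        (∀ i, Mono (s'.f i)) ∧ Nonempty (Homotopy s' (s ≫ h.hom)) := by
  have hK := CochainComplex.mappingCone.homotopyToZeroOfId F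
  refine ⟨G ⊞ CochainComplex.mappingCone (𝟙 F), fun i => ?_, HomotopyEquiv.biprodInl G _ hK,
    biprod.lift s (CochainComplex.mappingCone.inr (𝟙 F)), fun i => ?_, ⟨hK.biprodLift _ _⟩⟩
  · have := CochainComplex.injective_mappingCone_X (𝟙 F) i
    exact CochainComplex.injective_biprod_X i
  · have := CochainComplex.mono_mappingCone_inr_f (𝟙 F) i
    exact mono_of_mono_fac (HomologicalComplex.biprod_lift_snd_f _ _ i)
end

section
/- Consider categories C, C', D, D' and functors F : C → C', G : D → D', H : C → D, H' : C' → D' together with a natural isomorphism α : G ∘ H ≅ H' ∘ F, such that F and G are fully faithful and the following holds: whenever H'(C') is isomorphic to G(D) for objects C' of C' and D of D, there exists an object C of C with C' isomorphic to F(C). Let f : D₁ → D₂ be a morphism in D, let C₂ be an object of C and c₂ : D₂ ≅ H(C₂) an isomorphism, and set c₂' := α_{C₂} ∘ G(c₂) : G(D₂) ≅ H'(F(C₂)). Then the canonical map Lift_H(f | c₂) → Lift_{H'}(G(f) | c₂'), sending the class of a lift (C₁, c₁, f̄) to the class of (F(C₁), α_{C₁} ∘ G(c₁), F(f̄)), is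 well defined and bijective. -/
open CategoryTheory

universe v₁ v₂ v₃ v₄ u₁ u₂ u₃ u₄

variable {C : Type u₁} {C' : Type u₂} {D : Type u₃} {D' : Type u₄}
  [Category.{v₁} C] [Category.{v₂} C'] [Category.{v₃} D] [Category.{v₄} D']

/-- A lift of a morphism `f : D₁ ⟶ D₂` along a functor `H : C ⥤ D`, relative to a fixed
lift `c₂ : D₂ ≅ H.obj C₂` of the codomain: an object `C₁`, an isomorphism
`c₁ : D₁ ≅ H.obj C₁` and a morphism `f̄ : C₁ ⟶ C₂` with `H(f̄) ∘ c₁ = c₂ ∘ f`. -/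
structure LiftOfHom (H : C ⥤ D) {D₁ D₂ : D} (f : D₁ ⟶ D₂) {C₂ : C}
    (c₂ : D₂ ≅ H.obj C₂) where
  C₁ : C
  c₁ : D₁ ≅ H.obj C₁
  fbar : C₁ ⟶ C₂
  comm : c₁.hom ≫ H.map fbar = f ≫ c₂.hom

/-- Isomorphism of lifts: an isomorphism `φ : C₁ ≅ C₁'` compatible with the morphisms to
`C₂` and with the isomorphisms `c₁`, `c₁'`. -/
def LiftOfHom.Isomorphic (H : C ⥤ D) {D₁ D₂ : D} (f : D₁ ⟶ D₂) {C₂ : C}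
    (c₂ : D₂ ≅ H.obj C₂) (l l' : LiftOfHom H f c₂) : Prop :=
  ∃ φ : l.C₁ ≅ l'.C₁, φ.hom ≫ l'.fbar = l.fbar ∧ l.c₁.hom ≫ H.map φ.hom = l'.c₁.hom

/-- The set of lifts `Lift_H(f ∣ c₂)`: isomorphism classes of lifts of `f` with fixed lift
`c₂` of the codomain. -/
def LiftSet (H : C ⥤ D) {D₁ D₂ : D} (f : D₁ ⟶ D₂) {C₂ : C} (c₂ : D₂ ≅ H.obj C₂) :=
  Quot (LiftOfHom.Isomorphic H f c₂)

/-- The canonical image of a lift of `f` along `H` as a lift of `G.map f` along `H'`,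
using the natural isomorphism `α : H ⋙ G ≅ F ⋙ H'`. -/
def LiftOfHom.push (F : C ⥤ C') (G : D ⥤ D') (H : C ⥤ D) (H' : C' ⥤ D')
    (α : H ⋙ G ≅ F ⋙ H') {D₁ D₂ : D} (f : D₁ ⟶ D₂) {C₂ : C} (c₂ : D₂ ≅ H.obj C₂)
    (l : LiftOfHom H f c₂) :
    LiftOfHom H' (G.map f) (G.mapIso c₂ ≪≫ α.app C₂) where
  C₁ := F.obj l.C₁
  c₁ := G.mapIso l.c₁ ≪≫ α.app l.C₁
  fbar := F.map l.fbar
  comm := by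
    have h₁ := α.hom.naturality l.fbar
    dsimp at h₁ ⊢
    rw [Category.assoc, ← h₁, ← Category.assoc, ← G.map_comp, l.comm,
      G.map_comp, Category.assoc]

/-- Isomorphism of lifts is an equivalence relation. -/
theorem LiftOfHom.isomorphic_equivalence (H : C ⥤ D) {D₁ D₂ : D} (f : D₁ ⟶ D₂) {C₂ : C}
    (c₂ : D₂ ≅ H.obj C₂) : Equivalence (LiftOfHom.Isomorphic H f c₂) where
  refl l := ⟨Iso.refl _, by simp, by simp⟩
  symm := by
    rintro l l' ⟨φ, h₁, h₂⟩
    exact ⟨φ.symm, by simp [← h₁], by simp [← h₂, ← H.map_comp]⟩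
  trans := by
    rintro l l' l'' ⟨φ, h₁, h₂⟩ ⟨ψ, h₃, h₄⟩
    exact ⟨φ ≪≫ ψ, by simp [h₃, h₁], by simp [← h₄, ← h₂]⟩

/-- Two lifts define the same class if and only if they are isomorphic. -/
theorem LiftOfHom.mk_eq_mk_iff (H : C ⥤ D) {D₁ D₂ : D} (f : D₁ ⟶ D₂) {C₂ : C}
    (c₂ : D₂ ≅ H.obj C₂) (l l' : LiftOfHom H f c₂) :
    (Quot.mk _ l : LiftSet H f c₂) = Quot.mk _ l' ↔ LiftOfHom.Isomorphic H f c₂ l l' :=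
  (LiftOfHom.isomorphic_equivalence H f c₂).quot_mk_eq_iff l l'

section Push

variable (F : C ⥤ C') (G : D ⥤ D') (H : C ⥤ D) (H' : C' ⥤ D') (α : H ⋙ G ≅ F ⋙ H')
  {D₁ D₂ : D} (f : D₁ ⟶ D₂) {C₂ : C} (c₂ : D₂ ≅ H.obj C₂)

/-- Pushing forward lifts preserves isomorphism of lifts. -/
theorem LiftOfHom.Isomorphic.push {l l' : LiftOfHom H f c₂}
    (h : LiftOfHom.Isomorphic H f c₂ l l') :
    LiftOfHom.Isomorphic H' (G.map f) (G.mapIso c₂ ≪≫ α.app C₂)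
      (l.push F G H H' α f c₂) (l'.push F G H H' α f c₂) := by
  obtain ⟨φ, h₁, h₂⟩ := h
  refine ⟨F.mapIso φ, ?_, ?_⟩
  · simp [LiftOfHom.push, ← h₁]
  · have h := α.hom.naturality φ.hom
    dsimp at h
    simp [LiftOfHom.push, ← h₂, h]

/-- If `F` is fully faithful and `G` is faithful, pushing forward lifts reflects isomorphism
of lifts. -/
theorem LiftOfHom.isomorphic_of_push [F.Full] [F.Faithful] [G.Faithful]
    {l l' : LiftOfHom H f c₂}
    (h : LiftOfHom.Isomorphic H' (G.map f) (G.mapIso c₂ ≪≫ α.app C₂)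
      (l.push F G H H' α f c₂) (l'.push F G H H' α f c₂)) :
    LiftOfHom.Isomorphic H f c₂ l l' := by
  obtain ⟨φ, h₁, h₂⟩ := h
  obtain ⟨ψ, rfl⟩ : ∃ ψ : l.C₁ ≅ l'.C₁, F.mapIso ψ = φ :=
    ⟨F.preimageIso φ, Iso.ext (F.map_preimage φ.hom)⟩
  refine ⟨ψ, F.map_injective ?_, G.map_injective ?_⟩
  · simpa [LiftOfHom.push] using h₁
  · have h := α.hom.naturality ψ.hom
    dsimp [LiftOfHom.push] at h h₂
    rw [Category.assoc, ← h, ← Category.assoc, cancel_mono] at h₂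
    simpa using h₂

/-- Under condition (L), every lift of `G.map f` is isomorphic to the pushforward of a lift
of `f`. -/
theorem LiftOfHom.exists_push_isomorphic [F.Full] [G.Full] [G.Faithful]
    (hL : ∀ (X : C') (Y : D), Nonempty (H'.obj X ≅ G.obj Y) →
      ∃ Z : C, Nonempty (X ≅ F.obj Z))
    (m : LiftOfHom H' (G.map f) (G.mapIso c₂ ≪≫ α.app C₂)) :
    ∃ l : LiftOfHom H f c₂,
      LiftOfHom.Isomorphic H' (G.map f) (G.mapIso c₂ ≪≫ α.app C₂)
        (l.push F G H H' α f c₂) m := by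
  obtain ⟨Z, ⟨e⟩⟩ := hL m.C₁ D₁ ⟨m.c₁.symm⟩
  obtain ⟨c, hc⟩ : ∃ c : D₁ ≅ H.obj Z,
      G.mapIso c = m.c₁ ≪≫ H'.mapIso e ≪≫ (α.app Z).symm :=
    ⟨G.preimageIso (m.c₁ ≪≫ H'.mapIso e ≪≫ (α.app Z).symm), by ext; simp⟩
  obtain ⟨g, hg⟩ := F.map_surjective (e.inv ≫ m.fbar)
  have hc' : G.map c.hom ≫ α.hom.app Z = m.c₁.hom ≫ H'.map e.hom := by
    have h := congrArg Iso.hom hc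
    dsimp at h
    simp [h]
  have hcomm : c.hom ≫ H.map g = f ≫ c₂.hom := by
    apply G.map_injective
    have h := α.hom.naturality g
    have hm := m.comm
    dsimp at h hm
    rw [← cancel_mono (α.hom.app C₂), G.map_comp, G.map_comp, Category.assoc, h,
      ← Category.assoc, hc', hg, Category.assoc, ← H'.map_comp, e.hom_inv_id_assoc, hm,
      Category.assoc]
  refine ⟨⟨Z, c, g, hcomm⟩, e.symm, ?_, ?_⟩
  · simp [LiftOfHom.push, hg]
  · dsimp [LiftOfHom.push]
    rw [hc', Category.assoc, ← H'.map_comp, e.hom_inv_id, H'.map_id, Category.comp_id]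

end Push

/-- **Comparison of lift groupoids** (Proposition 3.5 of the paper, version for morphisms).
Suppose the square of functors `F, G, H, H'` with natural isomorphism
`α : G ∘ H ≅ H' ∘ F` satisfies condition (L): `F` and `G` are fully faithful, and whenever
`H'(C')` is isomorphic to `G(D)` there is an object `C` of `C` with `C' ≅ F(C)`.
Then for any morphism `f : D₁ ⟶ D₂` in `D` and any lift `c₂ : D₂ ≅ H(C₂)` of the codomain,
the canonical map `Lift_H(f ∣ c₂) → Lift_{H'}(G(f) ∣ c₂')` (sending the class of
`(C₁, c₁, f̄)` to the class of `(F(C₁), α_{C₁} ∘ G(c₁), F(f̄))`) is well defined and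
bijective. -/
theorem liftSet_equiv_of_condition_L
    (F : C ⥤ C') (G : D ⥤ D') (H : C ⥤ D) (H' : C' ⥤ D')
    (α : H ⋙ G ≅ F ⋙ H')
    [F.Full] [F.Faithful] [G.Full] [G.Faithful]
    (hL : ∀ (X : C') (Y : D), Nonempty (H'.obj X ≅ G.obj Y) →
      ∃ Z : C, Nonempty (X ≅ F.obj Z))
    {D₁ D₂ : D} (f : D₁ ⟶ D₂) {C₂ : C} (c₂ : D₂ ≅ H.obj C₂) :
    ∃ Φ : LiftSet H f c₂ ≃ LiftSet H' (G.map f) (G.mapIso c₂ ≪≫ α.app C₂),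
      ∀ l : LiftOfHom H f c₂,
        Φ (Quot.mk _ l) = Quot.mk _ (l.push F G H H' α f c₂) := by
  refine ⟨Equiv.ofBijective
    (Quot.map (LiftOfHom.push F G H H' α f c₂)
      fun _ _ h => LiftOfHom.Isomorphic.push F G H H' α f c₂ h) ⟨?_, ?_⟩, fun _ => rfl⟩
  · rintro ⟨l⟩ ⟨l'⟩ h
    exact Quot.sound (LiftOfHom.isomorphic_of_push F G H H' α f c₂
      ((LiftOfHom.mk_eq_mk_iff _ _ _ _ _).1 h))
  · rintro ⟨m⟩
    obtain ⟨l, hl⟩ := LiftOfHom.exists_push_isomorphic F G H H' α f c₂ hL m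
    exact ⟨Quot.mk _ l, Quot.sound hl⟩
end

section
/- Let A be an additive category. For every i ∈ ℤ let J^i and K^i be objects of A and set I^i := J^i ⊕ K^i. Suppose given morphisms d₁₁^i : J^i → J^{i+1}, d₁₂^i : K^i → J^{i+1}, d₂₁^i : J^i → K^{i+1}, d₂₂^i : K^i → K^{i+1} such that the morphisms d^i : I^i → I^{i+1} with matrix (d₁₁^i, d₁₂^i; d₂₁^i, d₂₂^i) satisfy d^{i+1} ∘ d^i = 0, i.e. (I, d) is a cochain complex. Let β^i : J^i → K^i be morphisms with β^{i+1} ∘ d₁₂^i ∘ β^i = 0 for all i, let s̄^i : J^i → I^i be the morphism with components (1_{J^i}, β^i), and set φ^i := −β^{i+1} ∘ d₁₁^i + d₂₁^i + d₂₂^i ∘ β^i : J^i → K^{i+1}. Then the following are equivalent: (a) φ^i = 0 for all i; (b) there exists a family of morphisms δ^i : J^i → J^{i+1} such that d^i ∘ s̄^i = s̄^{i+1} ∘ δ^i for all i. Moreover, in that case necessarily δ^i = d₁₁^i + d₁₂^i ∘ β^i, and δ^{i+1} ∘ δ^i = 0, so s̄ embeds (J, δ) into (I, d) as a subcomplex.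 -/
open CategoryTheory CategoryTheory.Limits

/-- A morphism `(1, b)` into a biproduct intertwines a matrix morphism with `δ` if and only if the
two components of the composite agree. -/
lemma biprod_lift_id_comp_desc_eq_iff {A : Type*} [Category A] [Preadditive A]
    [HasBinaryBiproducts A] {X Y X' Y' : A} (a : X ⟶ X') (b : Y ⟶ X') (c : X ⟶ Y') (e : Y ⟶ Y')
    (f : X ⟶ Y) (f' : X' ⟶ Y') (δ : X ⟶ X') :
    biprod.lift (𝟙 X) f ≫ biprod.desc (biprod.lift a c) (biprod.lift b e) =
        δ ≫ biprod.lift (𝟙 X') f' ↔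
      a + f ≫ b = δ ∧ c + f ≫ e = δ ≫ f' := by
  constructor
  · intro h
    exact ⟨by simpa using h =≫ biprod.fst, by simpa using h =≫ biprod.snd⟩
  · rintro ⟨h₁, h₂⟩
    ext <;> simp [h₁, h₂]

/--
Let `A` be an additive category, `J K : ℤ → A` families of objects, and
`I i := J i ⊞ K i`.  Suppose the matrix morphisms
`d i = (d₁₁ i, d₁₂ i; d₂₁ i, d₂₂ i) : I i ⟶ I (i+1)` satisfy `d (i+1) ∘ d i = 0`, so that
`(I, d)` is a cochain complex.  Let `β i : J i ⟶ K i` satisfy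
`β (i+1) ∘ d₁₂ i ∘ β i = 0`, let `s̄ i := (1, β i) : J i ⟶ I i`, and set
`φ i := -β (i+1) ∘ d₁₁ i + d₂₁ i + d₂₂ i ∘ β i`.  Then `φ i = 0` for all `i` if and only if
there is a family `δ i : J i ⟶ J (i+1)` with `d i ∘ s̄ i = s̄ (i+1) ∘ δ i` for all `i`;
moreover any such `δ` necessarily satisfies `δ i = d₁₁ i + d₁₂ i ∘ β i` and
`δ (i+1) ∘ δ i = 0`, so `s̄` embeds `(J, δ)` into `(I, d)` as a subcomplex.
-/
theorem subcomplex_iff_varphi_zero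
    {A : Type*} [Category A] [Preadditive A] [HasBinaryBiproducts A]
    (J K : ℤ → A)
    (d11 : ∀ i : ℤ, J i ⟶ J (i + 1)) (d12 : ∀ i : ℤ, K i ⟶ J (i + 1))
    (d21 : ∀ i : ℤ, J i ⟶ K (i + 1)) (d22 : ∀ i : ℤ, K i ⟶ K (i + 1))
    (d : ∀ i : ℤ, J i ⊞ K i ⟶ J (i + 1) ⊞ K (i + 1))
    (hd : ∀ i, d i =
      biprod.desc (biprod.lift (d11 i) (d21 i)) (biprod.lift (d12 i) (d22 i)))
    (hdd : ∀ i, d i ≫ d (i + 1) = 0)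
    (β : ∀ i : ℤ, J i ⟶ K i)
    (hβ : ∀ i, β i ≫ d12 i ≫ β (i + 1) = 0)
    (sbar : ∀ i : ℤ, J i ⟶ J i ⊞ K i)
    (hsbar : ∀ i, sbar i = biprod.lift (𝟙 (J i)) (β i))
    (φ : ∀ i : ℤ, J i ⟶ K (i + 1))
    (hφ : ∀ i, φ i = -(d11 i ≫ β (i + 1)) + d21 i + β i ≫ d22 i) :
    ((∀ i, φ i = 0) ↔
      ∃ δ : ∀ i : ℤ, J i ⟶ J (i + 1), ∀ i, sbar i ≫ d i = δ i ≫ sbar (i + 1)) ∧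
    (∀ δ : ∀ i : ℤ, J i ⟶ J (i + 1),
      (∀ i, sbar i ≫ d i = δ i ≫ sbar (i + 1)) →
        ∀ i, δ i = d11 i + β i ≫ d12 i ∧ δ i ≫ δ (i + 1) = 0) := by
  have comm_iff (δ : ∀ i : ℤ, J i ⟶ J (i + 1)) (i : ℤ) :
      sbar i ≫ d i = δ i ≫ sbar (i + 1) ↔
        d11 i + β i ≫ d12 i = δ i ∧ d21 i + β i ≫ d22 i = δ i ≫ β (i + 1) := by
    rw [hsbar, hsbar, hd, biprod_lift_id_comp_desc_eq_iff]
  have hφ_iff (i : ℤ) : φ i = 0 ↔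
      d21 i + β i ≫ d22 i = (d11 i + β i ≫ d12 i) ≫ β (i + 1) := by
    rw [hφ, Preadditive.add_comp, Category.assoc, hβ, add_zero, add_assoc, neg_add_eq_zero,
      eq_comm]
  refine ⟨⟨fun h => ⟨fun i => d11 i + β i ≫ d12 i, fun i =>
      (comm_iff (fun i => d11 i + β i ≫ d12 i) i).2 ⟨rfl, (hφ_iff i).1 (h i)⟩⟩,
    ?_⟩, fun δ hδ i => ⟨((comm_iff δ i).1 (hδ i)).1.symm, ?_⟩⟩
  · rintro ⟨δ, hδ⟩ i
    obtain ⟨h₁, h₂⟩ := (comm_iff δ i).1 (hδ i)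
    rw [hφ_iff, h₁, h₂]
  · have h : (δ i ≫ δ (i + 1)) ≫ sbar (i + 1 + 1) = 0 := by
      rw [Category.assoc, ← hδ, ← Category.assoc, ← hδ, Category.assoc, hdd, comp_zero]
    simpa [hsbar] using h =≫ biprod.fst
end

section
/- Fix surjections of commutative noetherian rings R̄ ↠ R ↠ R₀ with kernels 𝔞 = ker(R̄ → R₀) and 𝔟 = ker(R̄ → R), satisfying 𝔞·𝔟 = 0 (so 𝔟² = 0). For every injective R-module I there exists an injective R̄-module Ī such that Hom_{R̄}(R, Ī) is isomorphic to I as an R-module; moreover Ī is unique up to isomorphism: if Ī' is another injective R̄-module with Hom_{R̄}(R, Ī') ≅ I as R-modules, then Ī ≅ Ī' as R̄-modules. -/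
open CategoryTheory

namespace CategoryTheory.Adjunction

variable {C D : Type*} [Category* C] [Category* D] {L : D ⥤ C} {G : C ⥤ D}

/-- If the counit is a monomorphism, the right adjoint is full on maps into injective objects. -/
lemma exists_map_eq_of_mono_counit (adj : L ⊣ G) {X Y : C} [Mono (adj.counit.app X)]
    [Injective Y] (g : G.obj X ⟶ G.obj Y) : ∃ f : X ⟶ Y, G.map f = g := by
  refine ⟨Injective.factorThru (L.map g ≫ adj.counit.app Y) (adj.counit.app X), ?_⟩
  apply (adj.homEquiv _ _).symm.injective
  simp [Adjunction.homEquiv_counit]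

end CategoryTheory.Adjunction

namespace CategoryTheory.Functor

variable {C D : Type*} [Category* C] [Category* D] [Preadditive C] [Preadditive D]
  {G : C ⥤ D} [G.Additive]

/-- An idempotent lifts along an additive functor which is surjective on endomorphisms, with
square-zero kernel. -/
lemma exists_idempotent_map_eq {X : C} (hG : ∀ f : X ⟶ X, G.map f = 0 → f ≫ f = 0)
    (f : X ⟶ X) (hf : G.map f ≫ G.map f = G.map f) :
    ∃ e : X ⟶ X, e ≫ e = e ∧ G.map e = G.map f := by
  have h := hG (f ≫ f - f) (by simp [hf])
  refine ⟨3 • (f ≫ f) - 2 • (f ≫ f ≫ f), ?_, ?_⟩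
  · change (End.of f * End.of f - End.of f) * (End.of f * End.of f - End.of f) = 0 at h
    change (3 • (End.of f * End.of f) - 2 • (End.of f * End.of f * End.of f)) *
      (3 • (End.of f * End.of f) - 2 • (End.of f * End.of f * End.of f)) =
      3 • (End.of f * End.of f) - 2 • (End.of f * End.of f * End.of f)
    generalize End.of f = a at h ⊢
    rw [← sub_eq_zero]
    calc _ = ((a * a - a) * (a * a - a)) * (4 • (a * a) - 4 • a - 3 • 1) := by noncomm_ring
      _ = 0 := by rw [h, zero_mul]
  · simp only [map_sub, map_nsmul, map_comp, hf]
    module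

/-- If maps killed by `G` square to zero, then an endomorphism sent by `G` to the identity has
a two-sided inverse. -/
lemma isIso_of_map_eq_id {X : C} (hG : ∀ f : X ⟶ X, G.map f = 0 → f ≫ f = 0)
    (u : X ⟶ X) (hu : G.map u = 𝟙 _) : IsIso u := by
  have h := hG (u - 𝟙 X) (by simp [hu])
  simp only [Preadditive.sub_comp, Preadditive.comp_sub, Category.comp_id, Category.id_comp] at h
  have h' : u ≫ u = u + u - 𝟙 X := by rw [← sub_eq_zero, ← h]; abel
  refine ⟨𝟙 X + 𝟙 X - u, ?_, ?_⟩ <;>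
    simp only [Preadditive.sub_comp, Preadditive.comp_sub, Preadditive.add_comp,
      Preadditive.comp_add, Category.comp_id, Category.id_comp, h'] <;> abel

end CategoryTheory.Functor

namespace CategoryTheory.Adjunction

variable {C D : Type*} [Category* C] [Category* D] [Preadditive C] [Preadditive D]
  {L : D ⥤ C} {G : C ⥤ D} [G.Additive]

lemma nonempty_iso_of_injective (adj : L ⊣ G) [∀ X, Mono (adj.counit.app X)]
    (hG : ∀ (X : C) (f : X ⟶ X), G.map f = 0 → f ≫ f = 0)
    {X Y : C} [Injective X] [Injective Y] (i : G.obj X ≅ G.obj Y) : Nonempty (X ≅ Y) := by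
  obtain ⟨f, hf⟩ := adj.exists_map_eq_of_mono_counit i.hom
  obtain ⟨g, hg⟩ := adj.exists_map_eq_of_mono_counit i.inv
  have := G.isIso_of_map_eq_id (hG X) (f ≫ g) (by simp [hf, hg])
  have := G.isIso_of_map_eq_id (hG Y) (g ≫ f) (by simp [hf, hg])
  have : Mono f := mono_of_mono f g
  have : IsSplitEpi f := ⟨⟨inv (g ≫ f) ≫ g, by simp⟩⟩
  have := isIso_of_mono_of_isSplitEpi f
  exact ⟨asIso f⟩

lemma exists_injective_lift [IsIdempotentComplete C] [EnoughInjectives C] (adj : L ⊣ G)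
    [L.Faithful] [∀ X, Mono (adj.counit.app X)]
    (hG : ∀ (X : C) (f : X ⟶ X), G.map f = 0 → f ≫ f = 0) (I : D) [Injective I] :
    ∃ X : C, Injective X ∧ Nonempty (G.obj X ≅ I) := by
  let J := Injective.under (L.obj I)
  let ι := adj.homEquiv I J (Injective.ι (L.obj I))
  have hι : L.map ι ≫ adj.counit.app J = Injective.ι (L.obj I) := by
    simp [ι, ← adj.homEquiv_counit]
  have : Mono (L.map ι ≫ adj.counit.app J) := hι ▸ inferInstance
  have : Mono ι := L.mono_of_mono_map (mono_of_mono _ (adj.counit.app J))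
  let r := Injective.factorThru (𝟙 I) ι
  have hr : ι ≫ r = 𝟙 I := Injective.comp_factorThru _ _
  obtain ⟨f, hf⟩ := adj.exists_map_eq_of_mono_counit (r ≫ ι)
  obtain ⟨e, he, hef⟩ := G.exists_idempotent_map_eq (hG J) f (by simp [hf, reassoc_of% hr])
  obtain ⟨X, s, t, hst, hts⟩ := IsIdempotentComplete.idempotents_split J e he
  have hGst : G.map s ≫ G.map t = 𝟙 _ := by rw [← G.map_comp, hst, G.map_id]
  have hGts : G.map t ≫ G.map s = r ≫ ι := by rw [← G.map_comp, hts, hef, hf]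
  refine ⟨X, Retract.injective ⟨s, t, hst⟩, ⟨⟨G.map s ≫ r, ι ≫ G.map t, ?_, ?_⟩⟩⟩
  · rw [Category.assoc, ← reassoc_of% hGts, hGst, Category.comp_id, hGst]
  · rw [Category.assoc, reassoc_of% hGts, reassoc_of% hr, hr]

end CategoryTheory.Adjunction

namespace ModuleCat

universe v u₁ u₂

variable {A : Type u₁} {B : Type u₂} [CommRing A] [CommRing B] (p : A →+* B)

instance coextendScalars_additive : (coextendScalars.{u₁, u₂, v} p).Additive where
  map_add := rfl

variable {p}

lemma mono_restrictCoextendScalarsAdj_counit (hp : Function.Surjective p)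
    (M : ModuleCat.{max v u₂} A) :
    Mono ((restrictCoextendScalarsAdj.{v} p).counit.app M) := by
  rw [ModuleCat.mono_iff_injective]
  intro (g : (coextendScalars p).obj M) (g' : (coextendScalars p).obj M) h
  replace h : g (1 : B) = g' (1 : B) := h
  refine CoextendScalars.ext (LinearMap.ext fun (b : B) ↦ ?_)
  obtain ⟨a, rfl⟩ := hp b
  have key (k : (coextendScalars p).obj M) : k (p a) = a • k (1 : B) := by
    refine Eq.trans (congrArg _ ?_) ((CoextendScalars.equiv p M k).map_smul a (1 : B))
    exact (mul_one (p a)).symm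
  exact (key g).trans ((congrArg (a • ·) h).trans (key g').symm)

lemma exists_coextendScalars_apply_one_eq (hp : Function.Surjective p)
    (M : ModuleCat.{v} A) (m : M) (hm : ∀ a ∈ RingHom.ker p, a • m = 0) :
    ∃ g : (coextendScalars p).obj M, g (1 : B) = m := by
  have key {a a' : A} (h : p a = p a') : a • m = a' • m := by
    rw [← sub_eq_zero, ← sub_smul]
    exact hm _ (by simp [RingHom.mem_ker, h])
  let s := Function.surjInv hp
  have hs (b : B) : p (s b) = b := Function.surjInv_eq hp b
  refine ⟨(CoextendScalars.equiv p M).symm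
    { toFun := fun b : B ↦ s b • m
      map_add' := fun (b b' : B) ↦ ?_
      map_smul' := fun a (b : B) ↦ ?_ }, ?_⟩
  · rw [← add_smul]
    exact key ((hs (b + b')).trans (by rw [map_add, hs, hs]))
  · rw [RingHom.id_apply, ← mul_smul]
    exact key ((hs (p a * b)).trans (by rw [map_mul, hs]))
  · exact (key (by rw [hs, map_one])).trans (one_smul A m)

lemma comp_eq_zero_of_coextendScalars_map_eq_zero (hp : Function.Surjective p)
    (hsq : ∀ a ∈ RingHom.ker p, ∀ b ∈ RingHom.ker p, a * b = 0)
    {M N P : ModuleCat.{v} A} (f : M ⟶ N) (g : N ⟶ P)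
    (hf : (coextendScalars.{u₁, u₂, v} p).map f = 0)
    (hg : (coextendScalars.{u₁, u₂, v} p).map g = 0) : f ≫ g = 0 := by
  have key {X Y : ModuleCat.{v} A} (φ : X ⟶ Y)
      (hφ : (coextendScalars.{u₁, u₂, v} p).map φ = 0) (x : X)
      (hx : ∀ a ∈ RingHom.ker p, a • x = 0) : φ x = 0 := by
    obtain ⟨k, rfl⟩ := exists_coextendScalars_apply_one_eq hp X x hx
    rw [← CoextendScalars.map_apply, hφ]
    rfl
  ext m
  refine key g hg _ fun b hb ↦ ?_
  rw [← map_smul]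
  exact key f hf _ fun a ha ↦ by rw [← mul_smul, hsq a ha b hb, zero_smul]

end ModuleCat

/--
**Unique lifting of injective objects (Lemma 2.2 of the paper), for module categories.**
Fix surjections of commutative noetherian rings `R̄ ↠ R ↠ R₀` with `𝔞 := ker(R̄ → R₀)`,
`𝔟 := ker(R̄ → R)` and `𝔞·𝔟 = 0`.  For every injective `R`-module `I` there exists an
injective `R̄`-module `Ī` with `Hom_{R̄}(R, Ī) ≅ I` as `R`-modules, and `Ī` is unique up
to isomorphism of `R̄`-modules among injective `R̄`-modules with this property.
-/
theorem exists_unique_injective_lift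
    {Rb R R₀ : Type} [CommRing Rb] [CommRing R] [CommRing R₀]
    [IsNoetherianRing Rb] [IsNoetherianRing R] [IsNoetherianRing R₀]
    (p : Rb →+* R) (q : R →+* R₀)
    (hp : Function.Surjective p) (hq : Function.Surjective q)
    (hab : ∀ a ∈ RingHom.ker (q.comp p), ∀ b ∈ RingHom.ker p, a * b = 0)
    (I : ModuleCat R) (hI : Injective I) :
    ∃ Ib : ModuleCat Rb, Injective Ib ∧
      Nonempty ((ModuleCat.coextendScalars p).obj Ib ≅ I) ∧
      ∀ Ib' : ModuleCat Rb, Injective Ib' →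
        Nonempty ((ModuleCat.coextendScalars p).obj Ib' ≅ I) →
        Nonempty (Ib ≅ Ib') := by
  have hsq : ∀ a ∈ RingHom.ker p, ∀ b ∈ RingHom.ker p, a * b = 0 := fun a ha b hb ↦
    hab a (by rw [RingHom.mem_ker] at ha ⊢; simp [ha]) b hb
  let adj := ModuleCat.restrictCoextendScalarsAdj p
  have (M : ModuleCat Rb) : Mono (adj.counit.app M) :=
    ModuleCat.mono_restrictCoextendScalarsAdj_counit hp M
  have hG (M : ModuleCat Rb) (f : M ⟶ M) (hf : (ModuleCat.coextendScalars p).map f = 0) :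
      f ≫ f = 0 :=
    ModuleCat.comp_eq_zero_of_coextendScalars_map_eq_zero hp hsq f f hf hf
  obtain ⟨X, hX, ⟨i⟩⟩ := adj.exists_injective_lift hG I
  exact ⟨X, hX, ⟨i⟩, fun Y hY ⟨j⟩ ↦ adj.nonempty_iso_of_injective hG (i ≪≫ j.symm)⟩
end
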